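/- Let d ≥ 2 be an even integer. The function α_d satisfies: (1) for all u ∈ R, 0 ≤ log I₀(u) ≤ α_d(u) ≤ |u|; (2) for all u ∈ R, |α_d'(u)| ≤ 1; (3) as |u| → 0, α_d(u) ~ u²/2 if d = 2 and α_d(u) ~ u²/4 if d > 2; (4) as |u| → 0, α_d'(u) ~ u if d = 2 and α_d'(u) ~ u/2 if d > 2; (5) α_d is even, decreasing on (−∞, 0] and increasing on [0, ∞); (6) the function u ↦ α_d(u) − u is non-increasing on R. -/

import Mathlib

open scoped BigOperators Classical Topology

noncomputable section

/-- `α_d(u) = log((1/d) ∑_{k=0}^{d-1} exp(u cos(2kπ/d)))`. -/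
def alphad (d : ℕ) (u : ℝ) : ℝ :=
  Real.log ((1 / d : ℝ) * ∑ k ∈ Finset.range d, Real.exp (u * Real.cos (2 * k * Real.pi / d)))

/-- The modified Bessel function of the first kind of order `0`:
`I₀(x) = ∑_{k≥0} (x/2)^{2k}/(k!)²`. -/
def I0 (x : ℝ) : ℝ := ∑' k : ℕ, (x / 2) ^ (2 * k) / (Nat.factorial k : ℝ) ^ 2

open Real Finset in
/-- Orthogonality of characters on the `d`-th roots of unity, real form. -/
lemma sum_cos_int_mul (d : ℕ) (hd : d ≠ 0) (l : ℤ) :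
    ∑ k ∈ range d, cos (l * (2 * k * π / d)) = if (d : ℤ) ∣ l then (d : ℝ) else 0 := by
  have hd0 : (d : ℂ) ≠ 0 := by exact_mod_cast hd
  have hpi : (2 * π * Complex.I : ℂ) ≠ 0 := Complex.two_pi_I_ne_zero
  set z : ℂ := Complex.exp (2 * π * Complex.I * l / d) with hz
  have hre : ∑ k ∈ range d, cos (l * (2 * k * π / d)) = (∑ k ∈ range d, z ^ k).re := by
    rw [Complex.re_sum]
    refine sum_congr rfl fun k _ => ?_
    rw [hz, ← Complex.exp_nat_mul, ← Complex.exp_ofReal_mul_I_re]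
    congr 2
    push_cast
    ring
  have hpow : z ^ d = 1 := by
    rw [hz, ← Complex.exp_nat_mul, Complex.exp_eq_one_iff]
    exact ⟨l, by field_simp⟩
  rw [hre]
  split_ifs with h
  · obtain ⟨m, rfl⟩ := h
    have hz1 : z = 1 := by
      rw [hz, Complex.exp_eq_one_iff]
      exact ⟨m, by push_cast; field_simp⟩
    simp [hz1]
  · have hz1 : z ≠ 1 := by
      rw [hz, Ne, Complex.exp_eq_one_iff]
      rintro ⟨m, hm⟩
      apply h
      refine ⟨m, ?_⟩
      have : (l : ℂ) = d * m := by
        field_simp at hm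
        exact hm
      exact_mod_cast this
    rw [geom_sum_eq hz1, hpow]
    simp

open Real Finset in
lemma two_mul_cos_pow (n : ℕ) (t : ℝ) :
    (2 * cos t) ^ n = ∑ j ∈ range (n + 1), (n.choose j : ℝ) * cos ((2 * j - n : ℤ) * t) := by
  have h : ((2 * cos t : ℝ) : ℂ) ^ n = ∑ j ∈ range (n + 1),
      ((n.choose j : ℝ) : ℂ) * Complex.exp (((2 * j - n : ℤ) * t : ℝ) * Complex.I) := by
    have h2 : ((2 * cos t : ℝ) : ℂ) = Complex.exp (t * Complex.I) + Complex.exp (-t * Complex.I) := by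
      push_cast
      rw [Complex.two_cos]
    rw [h2, add_pow]
    refine sum_congr rfl fun j hj => ?_
    have hjn : j ≤ n := Nat.lt_succ_iff.mp (mem_range.mp hj)
    rw [← Complex.exp_nat_mul, ← Complex.exp_nat_mul, ← Complex.exp_add, mul_comm]
    congr 2
    push_cast [Nat.cast_sub hjn]
    ring
  have h' := congrArg Complex.re h
  rw [← Complex.ofReal_pow, Complex.ofReal_re, Complex.re_sum] at h'
  rw [h']
  refine sum_congr rfl fun j _ => ?_
  rw [Complex.re_ofReal_mul, Complex.exp_ofReal_mul_I_re]

open Real Finset in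
lemma centralBinom_le_sum_cos_pow (d : ℕ) (hd : d ≠ 0) (m : ℕ) :
    (d : ℝ) * m.centralBinom / 4 ^ m ≤ ∑ k ∈ range d, cos (2 * k * π / d) ^ (2 * m) := by
  have key : ∑ k ∈ range d, (2 * cos (2 * k * π / d)) ^ (2 * m) =
      ∑ j ∈ range (2 * m + 1), ((2 * m).choose j : ℝ) *
        (if (d : ℤ) ∣ (2 * j - (2 * m : ℕ) : ℤ) then (d : ℝ) else 0) := by
    simp_rw [two_mul_cos_pow]
    rw [sum_comm]
    refine sum_congr rfl fun j _ => ?_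
    rw [← mul_sum, sum_cos_int_mul d hd]
  have hm : ((2 * m).choose m : ℝ) * d ≤ ∑ k ∈ range d, (2 * cos (2 * k * π / d)) ^ (2 * m) := by
    rw [key]
    refine le_trans (le_of_eq ?_) (single_le_sum (f := fun j : ℕ => ((2 * m).choose j : ℝ) *
        (if (d : ℤ) ∣ (2 * j - (2 * m : ℕ) : ℤ) then (d : ℝ) else 0)) (fun j _ => ?_)
        (mem_range.mpr (show m < 2 * m + 1 by omega)))
    · simp
    · positivity
  rw [div_le_iff₀ (by positivity), sum_mul, Nat.centralBinom]
  rw [mul_comm]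
  refine hm.trans (le_of_eq (sum_congr rfl fun k _ => ?_))
  rw [mul_pow, pow_mul 2 2 m]
  norm_num [mul_comm]

open Real Finset in
/-- For even `d` the `d`-th roots of unity are symmetric about the imaginary axis. -/
lemma sum_cos_symm (d : ℕ) (hd : d ≠ 0) (hde : Even d) (f : ℝ → ℝ) :
    ∑ k ∈ range d, f (-cos (2 * k * π / d)) = ∑ k ∈ range d, f (cos (2 * k * π / d)) := by
  obtain ⟨e, rfl⟩ := hde
  have he : (e : ℝ) ≠ 0 := by
    rintro h
    have : e = 0 := by exact_mod_cast h
    omega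
  have hc : ∀ k : ℕ, cos (2 * (e + k : ℕ) * π / (e + e : ℕ)) =
      -cos (2 * k * π / (e + e : ℕ)) := by
    intro k
    rw [← cos_add_pi]
    congr 1
    push_cast
    field_simp
    ring
  rw [sum_range_add, sum_range_add]
  simp_rw [hc, neg_neg]
  rw [add_comm]

/-- The average of `exp (u cos (2kπ/d))` over `k`, so that `α_d` is its logarithm. -/
def expCosMean (d : ℕ) (u : ℝ) : ℝ :=
  (1 / d : ℝ) * ∑ k ∈ Finset.range d, Real.exp (u * Real.cos (2 * k * Real.pi / d))

lemma alphad_eq_log (d : ℕ) (u : ℝ) : alphad d u = Real.log (expCosMean d u) := rfl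

open Real Finset in
lemma expCosMean_pos (d : ℕ) (hd : d ≠ 0) (u : ℝ) : 0 < expCosMean d u := by
  have : 0 < d := Nat.pos_of_ne_zero hd
  exact mul_pos (by positivity) (sum_pos (fun k _ => exp_pos _) ⟨0, mem_range.mpr this⟩)

open Real Finset in
lemma expCosMean_eq_cosh (d : ℕ) (hd : d ≠ 0) (hde : Even d) (u : ℝ) :
    expCosMean d u = (1 / d : ℝ) * ∑ k ∈ range d, cosh (u * cos (2 * k * π / d)) := by
  have h := sum_cos_symm d hd hde fun c => exp (u * c)
  have h2 : ∑ k ∈ range d, cosh (u * cos (2 * k * π / d)) =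
      (∑ k ∈ range d, exp (u * cos (2 * k * π / d)) +
        ∑ k ∈ range d, exp (u * -cos (2 * k * π / d))) / 2 := by
    rw [← sum_add_distrib, sum_div]
    exact sum_congr rfl fun k _ => by rw [cosh_eq, mul_neg]
  rw [h2, h, expCosMean, add_self_div_two]

lemma expCosMean_zero (d : ℕ) (hd : d ≠ 0) : expCosMean d 0 = 1 := by
  have : (d : ℝ) ≠ 0 := by exact_mod_cast hd
  simp [expCosMean, this]

open Real Finset in
lemma expCosMean_strictMonoOn (d : ℕ) (hd : d ≠ 0) (hde : Even d) :
    StrictMonoOn (expCosMean d) (Set.Ici 0) := by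
  intro u hu v hv huv
  have hd' : 0 < d := Nat.pos_of_ne_zero hd
  have hu' : 0 ≤ u := hu
  have hv' : 0 ≤ v := hv
  rw [expCosMean_eq_cosh d hd hde, expCosMean_eq_cosh d hd hde]
  refine mul_lt_mul_of_pos_left (sum_lt_sum (fun k _ => ?_) ⟨0, mem_range.mpr hd', ?_⟩)
    (by positivity)
  · rw [cosh_le_cosh, abs_mul, abs_mul, abs_of_nonneg hu', abs_of_nonneg hv']
    gcongr
  · simpa [cosh_lt_cosh, abs_of_nonneg hu', abs_of_nonneg hv'] using huv

open Real Finset in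
lemma expCosMean_le_exp_abs (d : ℕ) (hd : d ≠ 0) (u : ℝ) : expCosMean d u ≤ exp |u| := by
  have hd' : (0 : ℝ) < d := by exact_mod_cast Nat.pos_of_ne_zero hd
  have h : ∑ k ∈ range d, exp (u * cos (2 * k * π / d)) ≤ ∑ _k ∈ range d, exp |u| := by
    refine sum_le_sum fun k _ => exp_le_exp.mpr ((le_abs_self _).trans ?_)
    rw [abs_mul]
    exact mul_le_of_le_one_right (abs_nonneg u) (abs_cos_le_one _)
  rw [sum_const, card_range, nsmul_eq_mul] at h
  rw [expCosMean, one_div, inv_mul_le_iff₀ hd']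
  exact h

open Real Finset in
lemma one_le_I0_and_I0_le_expCosMean (d : ℕ) (hd : d ≠ 0) (hde : Even d) (u : ℝ) :
    1 ≤ I0 u ∧ I0 u ≤ expCosMean d u := by
  have hd' : (0 : ℝ) < d := by exact_mod_cast Nat.pos_of_ne_zero hd
  have hF : HasSum (fun m : ℕ => (1 / d : ℝ) *
      ∑ k ∈ range d, (u * cos (2 * k * π / d)) ^ (2 * m) / ((2 * m).factorial : ℝ))
      (expCosMean d u) := by
    rw [expCosMean_eq_cosh d hd hde]
    exact (hasSum_sum fun k _ => hasSum_cosh _).mul_left _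
  have hle : ∀ m : ℕ, (u / 2) ^ (2 * m) / (m.factorial : ℝ) ^ 2 ≤ (1 / d : ℝ) *
      ∑ k ∈ range d, (u * cos (2 * k * π / d)) ^ (2 * m) / ((2 * m).factorial : ℝ) := by
    intro m
    have hfac : ((2 * m).factorial : ℝ) = m.centralBinom * (m.factorial : ℝ) ^ 2 := by
      have := Nat.choose_mul_factorial_mul_factorial (show m ≤ 2 * m by omega)
      rw [show 2 * m - m = m by omega] at this
      rw [Nat.centralBinom, ← this]
      push_cast
      ring
    have hcb : (0 : ℝ) < m.centralBinom := by exact_mod_cast m.centralBinom_pos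
    have hmf : (0 : ℝ) < m.factorial := by exact_mod_cast m.factorial_pos
    have hu : 0 ≤ u ^ (2 * m) := (even_two_mul m).pow_nonneg u
    have heq : (1 / d : ℝ) *
        ∑ k ∈ range d, (u * cos (2 * k * π / d)) ^ (2 * m) / ((2 * m).factorial : ℝ) =
        u ^ (2 * m) / (d * ((2 * m).factorial : ℝ)) *
          ∑ k ∈ range d, cos (2 * k * π / d) ^ (2 * m) := by
      rw [mul_sum, mul_sum]
      refine sum_congr rfl fun k _ => ?_
      rw [mul_pow]
      field_simp
    rw [heq]
    refine le_trans (le_of_eq ?_) (mul_le_mul_of_nonneg_left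
      (centralBinom_le_sum_cos_pow d hd m) (by positivity))
    rw [hfac, div_pow, pow_mul 2 2 m]
    norm_num
    field_simp
  have hnn : ∀ m : ℕ, 0 ≤ (u / 2) ^ (2 * m) / (m.factorial : ℝ) ^ 2 := fun m =>
    div_nonneg ((even_two_mul m).pow_nonneg _) (by positivity)
  have hs : Summable fun m : ℕ => (u / 2) ^ (2 * m) / (m.factorial : ℝ) ^ 2 :=
    Summable.of_nonneg_of_le hnn hle hF.summable
  constructor
  · have := hs.le_tsum 0 fun m _ => hnn m
    simpa [I0] using this
  · exact hasSum_le hle hs.hasSum hF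

open Real Finset in
lemma hasDerivAt_expCosMean (d : ℕ) (u : ℝ) :
    HasDerivAt (expCosMean d) ((1 / d : ℝ) *
      ∑ k ∈ range d, exp (u * cos (2 * k * π / d)) * cos (2 * k * π / d)) u := by
  refine HasDerivAt.const_mul _ (HasDerivAt.fun_sum fun k _ => ?_)
  exact (hasDerivAt_mul_const (cos (2 * k * π / d))).exp

open Real Finset in
lemma hasDerivAt_expCosMean_deriv_zero (d : ℕ) :
    HasDerivAt (fun u : ℝ => (1 / d : ℝ) *
      ∑ k ∈ range d, exp (u * cos (2 * k * π / d)) * cos (2 * k * π / d))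
      ((1 / d : ℝ) * ∑ k ∈ range d, cos (2 * k * π / d) ^ 2) 0 := by
  refine HasDerivAt.const_mul _ (HasDerivAt.fun_sum fun k _ => ?_)
  have h := ((hasDerivAt_mul_const (x := (0 : ℝ)) (cos (2 * k * π / d))).exp).mul_const
    (cos (2 * k * π / d))
  refine h.congr_deriv ?_
  simp [sq]

open Real Finset in
lemma mean_cos_sq (d : ℕ) (hd2 : 2 ≤ d) :
    (1 / d : ℝ) * ∑ k ∈ range d, cos (2 * k * π / d) ^ 2 = if d = 2 then 1 else 1 / 2 := by
  have hd : d ≠ 0 := by omega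
  have hd' : (d : ℝ) ≠ 0 := by exact_mod_cast hd
  have h : ∑ k ∈ range d, cos (2 * k * π / d) ^ 2 =
      d / 2 + (∑ k ∈ range d, cos ((2 : ℤ) * (2 * k * π / d))) / 2 := by
    rw [sum_div, show (d : ℝ) / 2 = ∑ _k ∈ range d, (1 / 2 : ℝ) by simp; ring, ← sum_add_distrib]
    refine sum_congr rfl fun k _ => ?_
    rw [cos_sq]
    push_cast
    ring
  have hdvd : ((d : ℤ) ∣ 2) ↔ d = 2 := by
    constructor
    · intro h
      have h2 : d ∣ 2 := by exact_mod_cast h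
      exact le_antisymm (Nat.le_of_dvd (by norm_num) h2) hd2
    · rintro rfl
      norm_num
  rw [h, sum_cos_int_mul d hd]
  simp only [hdvd]
  split_ifs
  · field_simp
    norm_num
  · field_simp
    norm_num

open Real Finset in
lemma hasDerivAt_alphad (d : ℕ) (hd : d ≠ 0) (u : ℝ) :
    HasDerivAt (alphad d) (((1 / d : ℝ) *
      ∑ k ∈ range d, exp (u * cos (2 * k * π / d)) * cos (2 * k * π / d)) / expCosMean d u) u :=
  (hasDerivAt_expCosMean d u).log (expCosMean_pos d hd u).ne'

open Real Finset in
lemma abs_deriv_alphad_le_one (d : ℕ) (hd : d ≠ 0) (u : ℝ) : |deriv (alphad d) u| ≤ 1 := by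
  rw [(hasDerivAt_alphad d hd u).deriv, abs_div, abs_of_pos (expCosMean_pos d hd u),
    div_le_one (expCosMean_pos d hd u), abs_mul, abs_of_nonneg (by positivity), expCosMean]
  gcongr
  refine (abs_sum_le_sum_abs _ _).trans (sum_le_sum fun k _ => ?_)
  rw [abs_mul, abs_of_pos (exp_pos _)]
  exact mul_le_of_le_one_right (exp_pos _).le (abs_cos_le_one _)

open Real Finset in
lemma deriv_alphad_zero (d : ℕ) (hd : d ≠ 0) (hde : Even d) : deriv (alphad d) 0 = 0 := by
  have h := sum_cos_symm d hd hde id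
  simp only [id, sum_neg_distrib] at h
  have h0 : ∑ k ∈ range d, cos (2 * k * π / d) = 0 := by linarith
  rw [(hasDerivAt_alphad d hd 0).deriv]
  simp [h0]

open Real Finset in
lemma hasDerivAt_deriv_alphad_zero (d : ℕ) (hd2 : 2 ≤ d) (hde : Even d) :
    HasDerivAt (deriv (alphad d)) (if d = 2 then 1 else 1 / 2) 0 := by
  have hd : d ≠ 0 := by omega
  have heq : deriv (alphad d) = fun u => ((1 / d : ℝ) *
      ∑ k ∈ range d, exp (u * cos (2 * k * π / d)) * cos (2 * k * π / d)) / expCosMean d u :=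
    funext fun u => (hasDerivAt_alphad d hd u).deriv
  have h0 := deriv_alphad_zero d hd hde
  rw [(hasDerivAt_alphad d hd 0).deriv, expCosMean_zero d hd, div_one] at h0
  have h := (hasDerivAt_expCosMean_deriv_zero d).div (hasDerivAt_expCosMean d 0)
    (expCosMean_pos d hd 0).ne'
  rw [h0, expCosMean_zero d hd, mean_cos_sq d hd2] at h
  rw [heq]
  refine HasDerivAt.congr_deriv h ?_
  simp

lemma isEquivalent_deriv_alphad (d : ℕ) (hd2 : 2 ≤ d) (hde : Even d) :
    Asymptotics.IsEquivalent (𝓝[≠] (0 : ℝ)) (deriv (alphad d))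
      (fun u => (if d = 2 then 1 else 1 / 2) * u) := by
  have hd : d ≠ 0 := by omega
  have h := (hasDerivAt_deriv_alphad_zero d hd2 hde).isLittleO
  simp only [deriv_alphad_zero d hd hde, sub_zero, smul_eq_mul] at h
  have hc : (if d = 2 then 1 else 1 / 2 : ℝ) ≠ 0 := by split_ifs <;> norm_num
  refine ((h.mono nhdsWithin_le_nhds).trans_isBigO
    (Asymptotics.isBigO_self_const_mul hc _ _)).congr_left fun u => ?_
  simp [mul_comm]

lemma isEquivalent_alphad (d : ℕ) (hd2 : 2 ≤ d) (hde : Even d) :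
    Asymptotics.IsEquivalent (𝓝[≠] (0 : ℝ)) (alphad d)
      (fun u => (if d = 2 then 1 else 1 / 2) * u ^ 2 / 2) := by
  have hd : d ≠ 0 := by omega
  have h := isEquivalent_deriv_alphad d hd2 hde
  have hc : (if d = 2 then 1 else 1 / 2 : ℝ) ≠ 0 := by split_ifs <;> norm_num
  generalize (if d = 2 then 1 else 1 / 2 : ℝ) = c at h hc ⊢
  have hne : ∀ᶠ u : ℝ in 𝓝[≠] 0, u ≠ 0 := self_mem_nhdsWithin
  rw [Asymptotics.isEquivalent_iff_tendsto_one
    (hne.mono fun u hu => by positivity)]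
  rw [Asymptotics.isEquivalent_iff_tendsto_one
    (hne.mono fun u hu => mul_ne_zero hc hu)] at h
  have hα : ContinuousAt (alphad d) 0 := (hasDerivAt_alphad d hd 0).continuousAt
  have hα0 : alphad d 0 = 0 := by rw [alphad_eq_log, expCosMean_zero d hd, Real.log_one]
  refine HasDerivAt.lhopital_zero_nhdsNE (f' := deriv (alphad d)) (g' := fun u => c * u)
    (.of_forall fun u => (hasDerivAt_alphad d hd u).differentiableAt.hasDerivAt)
    (.of_forall fun u => ?_) (hne.mono fun u hu => mul_ne_zero hc hu) ?_ ?_ h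
  · refine (((hasDerivAt_pow 2 u).const_mul c).div_const 2).congr_deriv ?_
    norm_num
    ring
  · simpa [hα0] using hα.tendsto.mono_left nhdsWithin_le_nhds
  · have : ContinuousAt (fun u : ℝ => c * u ^ 2 / 2) 0 := by fun_prop
    simpa using this.tendsto.mono_left nhdsWithin_le_nhds

lemma alphad_neg (d : ℕ) (hd : d ≠ 0) (hde : Even d) (u : ℝ) : alphad d (-u) = alphad d u := by
  rw [alphad_eq_log, alphad_eq_log, expCosMean_eq_cosh d hd hde, expCosMean_eq_cosh d hd hde]
  simp only [neg_mul, Real.cosh_neg]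

lemma alphad_strictMonoOn (d : ℕ) (hd : d ≠ 0) (hde : Even d) :
    StrictMonoOn (alphad d) (Set.Ici 0) := fun u hu _ hv huv =>
  Real.log_lt_log (expCosMean_pos d hd u) (expCosMean_strictMonoOn d hd hde hu hv huv)

lemma antitone_alphad_sub_id (d : ℕ) (hd : d ≠ 0) : Antitone fun u : ℝ => alphad d u - u := by
  have h : ∀ u, HasDerivAt (fun u : ℝ => alphad d u - u) (deriv (alphad d) u - 1) u := fun u =>
    (hasDerivAt_alphad d hd u).differentiableAt.hasDerivAt.sub (hasDerivAt_id u)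
  refine antitone_of_deriv_nonpos (fun u => (h u).differentiableAt) fun u => ?_
  rw [(h u).deriv]
  linarith [(abs_le.mp (abs_deriv_alphad_le_one d hd u)).2]

/-- Lemma 5.4: basic properties of `α_d` for even `d ≥ 2`:
(1) `0 ≤ log I₀(u) ≤ α_d(u) ≤ |u|`; (2) `|α_d'(u)| ≤ 1`;
(3) `α_d(u) ~ u²/2` (`d = 2`) resp. `u²/4` (`d > 2`) as `u → 0`;
(4) `α_d'(u) ~ u` (`d = 2`) resp. `u/2` (`d > 2`) as `u → 0`;
(5) `α_d` is even, decreasing on `(−∞,0]`, increasing on `[0,∞)`;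
(6) `u ↦ α_d(u) − u` is non-increasing. -/
theorem alphad_properties (d : ℕ) (hd2 : 2 ≤ d) (hde : Even d) :
    (∀ u : ℝ, 0 ≤ Real.log (I0 u) ∧ Real.log (I0 u) ≤ alphad d u ∧ alphad d u ≤ |u|) ∧
    (∀ u : ℝ, |deriv (alphad d) u| ≤ 1) ∧
    (if d = 2 then
        Asymptotics.IsEquivalent (𝓝[≠] (0:ℝ)) (alphad d) (fun u => u ^ 2 / 2)
      else
        Asymptotics.IsEquivalent (𝓝[≠] (0:ℝ)) (alphad d) (fun u => u ^ 2 / 4)) ∧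
    (if d = 2 then
        Asymptotics.IsEquivalent (𝓝[≠] (0:ℝ)) (deriv (alphad d)) (fun u => u)
      else
        Asymptotics.IsEquivalent (𝓝[≠] (0:ℝ)) (deriv (alphad d)) (fun u => u / 2)) ∧
    ((∀ u : ℝ, alphad d (-u) = alphad d u) ∧
      StrictAntiOn (alphad d) (Set.Iic (0:ℝ)) ∧ StrictMonoOn (alphad d) (Set.Ici (0:ℝ))) ∧
    (Antitone fun u : ℝ => alphad d u - u) := by
  have hd : d ≠ 0 := by omega
  have hmono := alphad_strictMonoOn d hd hde
  refine ⟨fun u => ?_, abs_deriv_alphad_le_one d hd, ?_, ?_,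
    ⟨alphad_neg d hd hde, fun u hu v hv huv => ?_, hmono⟩, antitone_alphad_sub_id d hd⟩
  · obtain ⟨h1, h2⟩ := one_le_I0_and_I0_le_expCosMean d hd hde u
    refine ⟨Real.log_nonneg h1, Real.log_le_log (by linarith) h2, ?_⟩
    rw [alphad_eq_log, Real.log_le_iff_le_exp (expCosMean_pos d hd u)]
    exact expCosMean_le_exp_abs d hd u
  · have h := isEquivalent_alphad d hd2 hde
    split_ifs with h2
    · simpa [h2] using h
    · rw [if_neg h2] at h
      refine h.congr_right (.of_forall fun u => ?_)
      ring
  · have h := isEquivalent_deriv_alphad d hd2 hde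
    split_ifs with h2
    · simpa [h2] using h
    · rw [if_neg h2] at h
      refine h.congr_right (.of_forall fun u => ?_)
      ring
  · rw [← alphad_neg d hd hde u, ← alphad_neg d hd hde v]
    exact hmono (by simpa using hv) (by simpa using hu) (neg_lt_neg huv)


end
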